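/- arXiv:0811.3062 — 2 statements merged into one kernel-verified Lean document; each statement's English description precedes it below -/
import Mathlib

section
/- For all integers r and s with 1 ≤ r ≤ s and s ≥ 40, Σ_{i=1}^{⌊r/40⌋} C(r, i) · C(s, ⌈s/2⌉) · (1/20)^{⌈s/2⌉} ≤ 2^{−s/4}, where C(·,·) denotes the binomial coefficient (the empty sum being 0 when ⌊r/40⌋ = 0). -/
open Finset

/-- Chernoff-type bound for a lower partial sum of binomial coefficients. -/
theorem sum_choose_le_two_pow_mul (r k : ℕ) (hk : k ≤ r) :
    ∑ i ∈ Finset.Icc 1 k, (r.choose i : ℝ) ≤ 2 ^ k * (3 / 2 : ℝ) ^ r := by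
  have hbinom : (3 / 2 : ℝ) ^ r = ∑ i ∈ Finset.range (r + 1), (1 / 2 : ℝ) ^ i * r.choose i := by
    rw [show (3 / 2 : ℝ) = 1 / 2 + 1 by norm_num, add_pow]
    simp
  rw [hbinom, Finset.mul_sum]
  calc ∑ i ∈ Finset.Icc 1 k, (r.choose i : ℝ)
      ≤ ∑ i ∈ Finset.Icc 1 k, 2 ^ k * ((1 / 2 : ℝ) ^ i * r.choose i) := by
        refine Finset.sum_le_sum fun i hi => ?_
        have hik := (Finset.mem_Icc.mp hi).2
        have hone : (1 : ℝ) ≤ 2 ^ k * (1 / 2) ^ i := by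
          rw [one_div, inv_pow, ← div_eq_mul_inv, one_le_div (by positivity)]
          exact pow_le_pow_right₀ (by norm_num) hik
        rw [← mul_assoc]
        exact le_mul_of_one_le_left (by positivity) hone
    _ ≤ _ := by
        refine Finset.sum_le_sum_of_subset_of_nonneg (fun i hi => ?_) fun i _ _ => by positivity
        rw [Finset.mem_Icc] at hi
        rw [Finset.mem_range]
        omega

/-- **Explicit combinatorial estimate for the second bin-ball game lemma.**
For integers `1 ≤ r ≤ s` with `s ≥ 40`,
`Σ_{i=1}^{⌊r/40⌋} C(r,i) · C(s,⌈s/2⌉) · (1/20)^{⌈s/2⌉} ≤ 2^{-s/4}`.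
(Here `⌊r/40⌋ = r / 40` and `⌈s/2⌉ = (s + 1) / 2` with natural-number division.) -/
theorem binBall_combinatorial_estimate
    (r s : ℕ) (h1 : 1 ≤ r) (hrs : r ≤ s) (hs : 40 ≤ s) :
    ∑ i ∈ Finset.Icc 1 (r / 40),
        (r.choose i : ℝ) * (s.choose ((s + 1) / 2) : ℝ) * (1 / 20 : ℝ) ^ ((s + 1) / 2)
      ≤ (2 : ℝ) ^ (-(s : ℝ) / 4) := by
  rw [← Finset.sum_mul, ← Finset.sum_mul]
  set m := (s + 1) / 2 with hm
  set k := r / 40 with hk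
  have hsum := sum_choose_le_two_pow_mul r k (by omega)
  have hchoose : (s.choose m : ℝ) ≤ 2 ^ s := by exact_mod_cast Nat.choose_le_two_pow s m
  have hr : (3 / 2 : ℝ) ^ r ≤ (3 / 2) ^ s := pow_le_pow_right₀ (by norm_num) hrs
  have hrhs : ((2 : ℝ) ^ (-(s : ℝ) / 4)) ^ 4 = (1 / 2) ^ s := by
    rw [← Real.rpow_natCast, ← Real.rpow_mul (by norm_num), one_div, inv_pow,
      ← Real.rpow_natCast 2 s, ← Real.rpow_neg (by norm_num)]
    congr 1
    push_cast
    ring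
  have hk4 : ((2 : ℝ) ^ k) ^ 4 ≤ 2 ^ s := by
    rw [← pow_mul]
    exact pow_le_pow_right₀ (by norm_num) (by omega)
  have hm4 : ((1 / 20 : ℝ) ^ m) ^ 4 ≤ (1 / 400) ^ s := by
    rw [show (1 / 400 : ℝ) = (1 / 20) ^ 2 by norm_num, ← pow_mul, ← pow_mul]
    exact pow_le_pow_of_le_one (by norm_num) (by norm_num) (by omega)
  calc (∑ i ∈ Finset.Icc 1 k, (r.choose i : ℝ)) * s.choose m * (1 / 20) ^ m
      ≤ 2 ^ k * (3 / 2) ^ s * 2 ^ s * (1 / 20) ^ m := by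
        gcongr
        exact hsum.trans (by gcongr)
    _ ≤ (2 : ℝ) ^ (-(s : ℝ) / 4) := by
        refine le_of_pow_le_pow_left₀ (n := 4) (by norm_num) (by positivity) ?_
        rw [hrhs]
        calc ((2 : ℝ) ^ k * (3 / 2) ^ s * 2 ^ s * (1 / 20) ^ m) ^ 4
            = (2 ^ k) ^ 4 * 81 ^ s * ((1 / 20) ^ m) ^ 4 := by
              rw [mul_assoc (2 ^ k : ℝ), ← mul_pow (3 / 2 : ℝ), mul_pow, mul_pow,
                pow_right_comm _ s 4]
              norm_num
          _ ≤ 2 ^ s * 81 ^ s * (1 / 400) ^ s := by gcongr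
          _ = (162 / 400) ^ s := by
              rw [← mul_pow, ← mul_pow]
              norm_num
          _ ≤ (1 / 2) ^ s := pow_le_pow_left₀ (by norm_num) (by norm_num) s
end

section
/- Let b ≥ 12 and c > 1 be reals, let m ≥ 1 and n be reals with n ≥ m·b^{1+2c}, and set φ = b^{−(c−1)/4} and δ = b^{−c}. Then for all reals k and λ with φ·n ≤ k ≤ n and φ ≤ λ ≤ 1, one has (2/3)·λk − λφn/2 − m ≥ m + (δ/φ)·k. -/
/-- **Slow-zone counting inequality for the first tradeoff.**
Let `b ≥ 12`, `c > 1`, `m ≥ 1` and `n ≥ m·b^(1+2c)`, and set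
`φ = b^(-(c-1)/4)` and `δ = b^(-c)`.  Then for all `k` with `φn ≤ k ≤ n` and
all `lam` with `φ ≤ lam ≤ 1`, one has
`(2/3)·lam·k - lam·φ·n/2 - m ≥ m + (δ/φ)·k`. -/
theorem slow_zone_counting_inequality
    (b c m n : ℝ) (hb : 12 ≤ b) (hc : 1 < c) (hm : 1 ≤ m)
    (hn : m * b ^ (1 + 2 * c) ≤ n)
    (φ δ : ℝ) (hφ : φ = b ^ (-(c - 1) / 4)) (hδ : δ = b ^ (-c))
    (k lam : ℝ) (hk1 : φ * n ≤ k) (hk2 : k ≤ n)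
    (hl1 : φ ≤ lam) (hl2 : lam ≤ 1) :
    m + (δ / φ) * k ≤ (2 / 3) * (lam * k) - lam * φ * n / 2 - m := by
  have hb0 : 0 < b := by linarith
  have hb1 : 1 ≤ b := by linarith
  have hφ0 : 0 < φ := hφ ▸ Real.rpow_pos_of_pos hb0 _
  have hφsq : φ * φ = b ^ (-(c - 1) / 2) := by
    rw [hφ, ← Real.rpow_add hb0]
    ring_nf
  have hδb : δ * b ≤ φ * φ := by
    rw [hφsq, hδ]
    nth_rewrite 2 [← Real.rpow_one b]
    rw [← Real.rpow_add hb0]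
    exact Real.rpow_le_rpow_of_exponent_le hb1 (by linarith)
  have hδ0 : 0 < δ := hδ ▸ Real.rpow_pos_of_pos hb0 _
  have hδφ : δ / φ ≤ φ / 12 := by
    rw [div_le_iff₀ hφ0]
    nlinarith
  have hpow : 24 ≤ φ * φ * b ^ (1 + 2 * c) := by
    rw [hφsq, ← Real.rpow_add hb0]
    calc (24 : ℝ) ≤ b ^ (2 : ℝ) := by
          rw [Real.rpow_two]
          nlinarith
      _ ≤ _ := Real.rpow_le_rpow_of_exponent_le hb1 (by linarith)
  have hm24 : 24 * m ≤ φ * k :=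
    calc 24 * m ≤ φ * φ * b ^ (1 + 2 * c) * m := by gcongr
      _ = φ * (φ * (m * b ^ (1 + 2 * c))) := by ring
      _ ≤ φ * (φ * n) := by gcongr
      _ ≤ φ * k := by gcongr
  have hk0 : 0 ≤ k := by
    by_contra! h
    nlinarith
  have hslow : δ / φ * k ≤ φ / 12 * k := by gcongr
  have hlam : lam * (φ * n) ≤ lam * k := mul_le_mul_of_nonneg_left hk1 (by linarith)
  have hlamk : φ * k ≤ lam * k := by gcongr
  linarith
end
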